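/- arXiv:1410.0423 — 3 statements merged into one kernel-verified Lean document; each statement's English description precedes it below -/
import Mathlib

section
/- Let $0<\alpha<1$, $K\subset\mathbb{R}^n$ an origin-symmetric convex body, and $E\subset\mathbb{R}^n$ a bounded Borel set. Then the anisotropic fractional isoperimetric inequality holds: $\alpha\, P_\alpha(E,K) \ge n\, V(K)^{\frac{n+\alpha}{n}}\, V(E)^{\frac{n-\alpha}{n}}$. -/
open MeasureTheory Set
open scoped ENNReal

noncomputable def sobNorm (n : ℕ) (α : ℝ) (K : Set (EuclideanSpace ℝ (Fin n)))
    (f : EuclideanSpace ℝ (Fin n) → ℝ) : ℝ≥0∞ :=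
  ∫⁻ x, ∫⁻ y, ENNReal.ofReal (|f x - f y| / gauge K (x - y) ^ ((n : ℝ) + α))

noncomputable def fracPerim (n : ℕ) (α : ℝ) (E K : Set (EuclideanSpace ℝ (Fin n))) : ℝ≥0∞ :=
  ∫⁻ x in E, ∫⁻ y in Eᶜ, ENNReal.ofReal (1 / gauge K (x - y) ^ ((n : ℝ) + α))

noncomputable def capCompact (n : ℕ) (α : ℝ) (K L : Set (EuclideanSpace ℝ (Fin n))) : ℝ≥0∞ :=
  ⨅ f ∈ {f : EuclideanSpace ℝ (Fin n) → ℝ |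
      ContDiff ℝ (⊤ : ℕ∞) f ∧ HasCompactSupport f ∧ ∀ x, L.indicator 1 x ≤ f x},
    sobNorm n α K f

noncomputable def capGen (n : ℕ) (α : ℝ) (K E : Set (EuclideanSpace ℝ (Fin n))) : ℝ≥0∞ :=
  ⨅ O ∈ {O : Set (EuclideanSpace ℝ (Fin n)) | IsOpen O ∧ E ⊆ O},
    ⨆ L ∈ {L : Set (EuclideanSpace ℝ (Fin n)) | IsCompact L ∧ L ⊆ O}, capCompact n α K L

/-- `O` has `C^∞` boundary: near each boundary point, `O` is a sublevel set of a smooth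
local defining function with nonvanishing derivative. -/
def SmoothBoundary {n : ℕ} (O : Set (EuclideanSpace ℝ (Fin n))) : Prop :=
  ∀ x ∈ frontier O, ∃ (U : Set (EuclideanSpace ℝ (Fin n))) (g : EuclideanSpace ℝ (Fin n) → ℝ),
    IsOpen U ∧ x ∈ U ∧ ContDiff ℝ (⊤ : ℕ∞) g ∧ (∀ y ∈ U, fderiv ℝ g y ≠ 0) ∧
    O ∩ U = {y ∈ U | g y < 0}

open scoped Pointwise in
theorem aux_lower (n : ℕ) (hn : 1 ≤ n) (α : ℝ) (hα0 : 0 < α)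
    (K : Set (EuclideanSpace ℝ (Fin n))) (hK₁ : IsCompact K) (hK₂ : Convex ℝ K)
    (hK0 : K ∈ nhds (0 : EuclideanSpace ℝ (Fin n)))
    (B : Set (EuclideanSpace ℝ (Fin n))) (hB : MeasurableSet B) (k r : ℝ) (hk : 0 < k)
    (hr : 0 < r) (hKv : volume K = ENNReal.ofReal k)
    (hBv : volume B = ENNReal.ofReal (r ^ n * k)) :
    ENNReal.ofReal (n / α * r ^ (-α) * k) ≤
      ∫⁻ z in Bᶜ, ENNReal.ofReal (1 / gauge K z ^ ((n : ℝ) + α)) := by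
  have hn0 : (0 : ℝ) < n := by exact_mod_cast hn
  have : Nonempty (Fin n) := ⟨⟨0, hn⟩⟩
  set p : ℝ := (n : ℝ) + α with hp
  have hp0 : 0 < p := by positivity
  have hcont : Continuous (gauge K) := continuous_gauge hK₂ hK0
  have habs : Absorbent ℝ K := absorbent_nhds_zero hK0
  have hbdd : Bornology.IsVonNBounded ℝ K :=
    NormedSpace.isVonNBounded_of_isBounded ℝ hK₁.isBounded
  rw [lintegral_eq_lintegral_meas_le]
  rotate_left
  · exact Filter.Eventually.of_forall fun z => by
      have := gauge_nonneg (s := K) z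
      show (0 : ℝ) ≤ 1 / gauge K z ^ p
      positivity
  · have : Measurable (gauge K) := hcont.measurable
    exact (Measurable.div measurable_const (this.pow_const p)).aemeasurable
  set T : ℝ := r ^ (-p) with hT
  have hT0 : 0 < T := by positivity
  have key : ∀ t : ℝ, 0 < t → ENNReal.ofReal (t ^ (-(n / p)) * k - r ^ n * k) ≤
      (volume.restrict Bᶜ) {a | t ≤ 1 / gauge K a ^ p} := by
    intro t ht
    set s : ℝ := t ^ (-(1 / p)) with hs
    have hs0 : 0 < s := by positivity
    have hsn : s ^ n = t ^ (-(n / p)) := by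
      rw [hs, ← Real.rpow_natCast, ← Real.rpow_mul ht.le]
      congr 1; ring
    have hsp : s ^ p = t⁻¹ := by
      rw [hs, ← Real.rpow_mul ht.le, ← Real.rpow_neg_one]
      congr 1; field_simp
    have hsub : (s • K) \ (B ∪ {0}) ⊆ {a | t ≤ 1 / gauge K a ^ p} ∩ Bᶜ := by
      rintro z ⟨⟨w, hw, rfl⟩, hz⟩
      simp only [mem_union, mem_singleton_iff, not_or] at hz
      refine ⟨?_, hz.1⟩
      show t ≤ 1 / gauge K (s • w) ^ p
      have h1 : gauge K (s • w) ≤ s := by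
        rw [gauge_smul_of_nonneg hs0.le, smul_eq_mul]
        have := gauge_le_one_of_mem hw
        nlinarith
      have h2 : 0 < gauge K (s • w) := (gauge_pos habs hbdd).2 hz.2
      have h3 : gauge K (s • w) ^ p ≤ t⁻¹ := by
        rw [← hsp]; exact Real.rpow_le_rpow h2.le h1 hp0.le
      have h4 : 0 < gauge K (s • w) ^ p := by positivity
      rw [le_div_iff₀ h4]
      calc t * gauge K (s • w) ^ p ≤ t * t⁻¹ := by gcongr
        _ = 1 := by field_simp
    rw [Measure.restrict_apply' hB.compl]
    refine le_trans ?_ (measure_mono hsub)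
    refine le_trans ?_ le_measure_sdiff
    have hun : volume (B ∪ {0}) ≤ ENNReal.ofReal (r ^ n * k) := by
      refine (measure_union_le _ _).trans ?_
      rw [hBv, measure_singleton, add_zero]
    have hv : volume (s • K) = ENNReal.ofReal (t ^ (-(n / p)) * k) := by
      rw [Measure.addHaar_smul, finrank_euclideanSpace_fin, hKv, abs_of_pos (by positivity),
        ← ENNReal.ofReal_mul (by positivity), hsn]
    rw [hv, ENNReal.ofReal_sub _ (by positivity)]
    exact tsub_le_tsub_left hun _
  have hexp : -1 < -(n / p) := by
    have : n / p < 1 := by rw [div_lt_one hp0]; linarith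
    linarith
  have hint : IntervalIntegrable (fun t : ℝ => t ^ (-(n / p)) * k - r ^ n * k) volume 0 T :=
    ((intervalIntegral.intervalIntegrable_rpow' hexp).mul_const k).sub
      intervalIntegrable_const
  have hval : ∫ t in (0 : ℝ)..T, (t ^ (-(n / p)) * k - r ^ n * k) = n / α * r ^ (-α) * k := by
    rw [intervalIntegral.integral_sub
      ((intervalIntegral.intervalIntegrable_rpow' hexp).mul_const k) intervalIntegrable_const,
      intervalIntegral.integral_mul_const, integral_rpow (Or.inl hexp),
      intervalIntegral.integral_const]
    have e1 : -(n / p) + 1 = α / p := by rw [hp] at hp0 ⊢; field_simp; ring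
    have e2 : T ^ (α / p) = r ^ (-α) := by
      rw [hT, ← Real.rpow_mul hr.le]; congr 1; field_simp
    have e3 : T * r ^ n = r ^ (-α) := by
      rw [hT, ← Real.rpow_natCast, ← Real.rpow_add hr]; congr 1; rw [hp]; ring
    rw [e1, e2, Real.zero_rpow (by positivity), smul_eq_mul, sub_zero, sub_zero, ← mul_assoc, e3, hp]
    rw [hp] at hp0
    field_simp
    ring
  rw [← hval, intervalIntegral.integral_of_le hT0.le, ofReal_integral_eq_lintegral_ofReal]
  · calc _ ≤ ∫⁻ t in Ioc 0 T, (volume.restrict Bᶜ) {a | t ≤ 1 / gauge K a ^ p} :=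
        setLIntegral_mono' measurableSet_Ioc fun t ht => key t ht.1
      _ ≤ _ := lintegral_mono_set Ioc_subset_Ioi_self
  · exact (intervalIntegrable_iff_integrableOn_Ioc_of_le hT0.le).1 hint
  · refine (ae_restrict_iff' measurableSet_Ioc).2 (Filter.Eventually.of_forall fun t ht => ?_)
    have h1 : T ^ (-(n / p)) ≤ t ^ (-(n / p)) :=
      Real.rpow_le_rpow_of_nonpos ht.1 ht.2 (by have : 0 < n / p := by positivity
                                                linarith)
    have h2 : T ^ (-(n / p)) = r ^ n := by
      rw [hT, ← Real.rpow_mul hr.le, ← Real.rpow_natCast]; congr 1; field_simp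
    rw [h2] at h1
    show 0 ≤ t ^ (-(n / p)) * k - r ^ n * k
    nlinarith

theorem stmt11 (n : ℕ) (hn : 1 ≤ n) (α : ℝ) (hα0 : 0 < α) (hα1 : α < 1)
    (K : Set (EuclideanSpace ℝ (Fin n))) (hK₁ : IsCompact K) (hK₂ : Convex ℝ K)
    (hK₃ : (interior K).Nonempty) (hK₄ : K = -K)
    (E : Set (EuclideanSpace ℝ (Fin n))) (hE : MeasurableSet E) (hEb : Bornology.IsBounded E) :
    ENNReal.ofReal α * fracPerim n α E K ≥
      (n : ℝ≥0∞) * volume K ^ (((n : ℝ) + α) / n) * volume E ^ (((n : ℝ) - α) / n) := by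
  have hn0 : (0 : ℝ) < n := by exact_mod_cast hn
  have hn1 : (1 : ℝ) ≤ n := by exact_mod_cast hn
  have hK0 : K ∈ nhds (0 : EuclideanSpace ℝ (Fin n)) := by
    obtain ⟨a, ha⟩ := hK₃
    rw [← mem_interior_iff_mem_nhds]
    have hna : -a ∈ K := by
      rw [hK₄]; simpa using interior_subset ha
    have := hK₂.combo_interior_self_mem_interior ha hna (a := 1/2) (b := 1/2)
      (by norm_num) (by norm_num) (by norm_num)
    simpa using this
  have hKpos : 0 < volume K := Measure.measure_pos_of_mem_nhds _ hK0
  have hKfin : volume K ≠ ∞ := hK₁.measure_lt_top.ne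
  have hEfin : volume E ≠ ∞ := hEb.measure_lt_top.ne
  rcases eq_or_ne (volume E) 0 with h0 | h0
  · rw [h0, ENNReal.zero_rpow_of_pos (div_pos (by linarith) hn0), mul_zero]
    exact zero_le
  obtain ⟨k, hk, hKv⟩ : ∃ k : ℝ, 0 < k ∧ volume K = ENNReal.ofReal k :=
    ⟨(volume K).toReal, ENNReal.toReal_pos hKpos.ne' hKfin, (ENNReal.ofReal_toReal hKfin).symm⟩
  obtain ⟨v, hv, hEv⟩ : ∃ v : ℝ, 0 < v ∧ volume E = ENNReal.ofReal v :=
    ⟨(volume E).toReal, ENNReal.toReal_pos h0 hEfin, (ENNReal.ofReal_toReal hEfin).symm⟩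
  set r : ℝ := (v / k) ^ (1 / (n : ℝ)) with hrdef
  have hr : 0 < r := by positivity
  have hrn : r ^ n * k = v := by
    rw [hrdef, ← Real.rpow_natCast, ← Real.rpow_mul (by positivity)]
    rw [one_div_mul_cancel hn0.ne', Real.rpow_one]; field_simp
  have inner : ∀ x : EuclideanSpace ℝ (Fin n), ENNReal.ofReal (n / α * r ^ (-α) * k) ≤
      ∫⁻ y in Eᶜ, ENNReal.ofReal (1 / gauge K (x - y) ^ ((n : ℝ) + α)) := by
    intro x
    have hmp := Measure.measurePreserving_sub_left (volume : Measure (EuclideanSpace ℝ (Fin n))) x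
    have hBm : MeasurableSet ((fun y => x - y) ⁻¹' E) := hmp.measurable hE
    have h := aux_lower n hn α hα0 K hK₁ hK₂ hK0 ((fun y => x - y) ⁻¹' E) hBm k r hk hr hKv
      (by rw [hmp.measure_preimage hE.nullMeasurableSet, hEv, hrn])
    refine h.trans (le_of_eq ?_)
    have hcont : Continuous (gauge K) := continuous_gauge hK₂ hK0
    have hm : Measurable fun z => ENNReal.ofReal (1 / gauge K z ^ ((n : ℝ) + α)) :=
      (Measurable.div measurable_const (hcont.measurable.pow_const _)).ennreal_ofReal
    rw [← hmp.setLIntegral_comp_preimage hBm.compl hm]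
    congr 2
    ext y
    simp
  have outer : ENNReal.ofReal (n / α * r ^ (-α) * k) * volume E ≤ fracPerim n α E K := by
    unfold fracPerim
    rw [← setLIntegral_const]
    exact lintegral_mono fun x => inner x
  refine le_trans (le_of_eq ?_) (mul_le_mul_right outer _)
  rw [hKv, hEv, ENNReal.ofReal_rpow_of_pos hk, ENNReal.ofReal_rpow_of_pos hv,
    ← ENNReal.ofReal_natCast, ← ENNReal.ofReal_mul (by positivity),
    ← ENNReal.ofReal_mul (by positivity), ← ENNReal.ofReal_mul (by positivity),
    ← ENNReal.ofReal_mul (by positivity)]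
  congr 1
  have e1 : ((n : ℝ) + α) / n = 1 + α / n := by field_simp
  have e2 : ((n : ℝ) - α) / n = 1 + -(α / n) := by field_simp; ring
  have e3 : r ^ (-α) = v ^ (-(α / n)) * k ^ (α / n) := by
    rw [hrdef, ← Real.rpow_mul (by positivity), Real.div_rpow hv.le hk.le, div_eq_mul_inv,
      ← Real.rpow_neg hk.le]
    congr 2 <;> ring
  rw [e1, e2, e3, Real.rpow_add hk, Real.rpow_add hv, Real.rpow_one, Real.rpow_one]
  field_simp
end

section
/- Let $0<\alpha<1$ and $K\subset\mathbb{R}^n$ an origin-symmetric convex body. For every compact set $L\subset\mathbb{R}^n$, the anisotropic fractional isocapacitary inequality holds: $\alpha\,\mathrm{cap}(L;\dot\Lambda^{1,1}_{\alpha,K}) \ge 2n\,V(K)^{\frac{n+\alpha}{n}}\,V(L)^{\frac{n-\alpha}{n}}$. -/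
open MeasureTheory Set
open scoped ENNReal

lemma aux_zero_mem {n : ℕ} {K : Set (EuclideanSpace ℝ (Fin n))} (hK₂ : Convex ℝ K)
    (hK₃ : (interior K).Nonempty) (hK₄ : K = -K) : (0 : EuclideanSpace ℝ (Fin n)) ∈ interior K := by
  obtain ⟨x, hx⟩ := hK₃
  have hx' : -x ∈ interior K := by
    rw [hK₄, show interior (-K) = -interior K from ?_]
    · simpa using hx
    · exact ((Homeomorph.neg (EuclideanSpace ℝ (Fin n))).preimage_interior K).symm
  have := hK₂.interior hx hx' (a := 1/2) (b := 1/2) (by norm_num) (by norm_num) (by norm_num)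
  simpa using this

lemma aux_gauge_cont {n : ℕ} {K : Set (EuclideanSpace ℝ (Fin n))} (hK₂ : Convex ℝ K)
    (h0 : (0 : EuclideanSpace ℝ (Fin n)) ∈ interior K) : Continuous (gauge K) :=
  continuous_gauge hK₂ (mem_interior_iff_mem_nhds.1 h0)

lemma aux_kernel (p g : ℝ) (hp : 0 < p) (hg : 0 < g) :
    ENNReal.ofReal (1 / g ^ p) =
      ∫⁻ s in Ioi (0:ℝ), {s : ℝ | g ≤ s}.indicator (fun s => ENNReal.ofReal (p * s ^ (-p - 1))) s := by
  rw [lintegral_indicator (by exact measurableSet_Ici), Measure.restrict_restrict (by exact measurableSet_Ici)]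
  have : {s : ℝ | g ≤ s} ∩ Ioi 0 = Ici g := by
    ext s; simp; intro h; linarith
  rw [this, ← restrict_Ioi_eq_restrict_Ici, ← ofReal_integral_eq_lintegral_ofReal]
  · rw [integral_const_mul, integral_Ioi_rpow_of_lt (by linarith) hg]
    congr 1
    rw [sub_add_cancel, Real.rpow_neg hg.le]
    field_simp
  · exact (integrableOn_Ioi_rpow_of_lt (by linarith) hg).const_mul p
  · filter_upwards [ae_restrict_mem measurableSet_Ioi] with s hs
    have : 0 < s := hg.trans hs
    positivity

lemma aux_int (n : ℕ) (hn : 1 ≤ n) (α V r : ℝ) (hα0 : 0 < α) (hr : 0 < r) :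
    (V * n / α * r ^ (-α)) =
      ∫ s in Ioi r, ((n + α) * s ^ (-(n + α) - 1)) * (V * s ^ n - V * r ^ n) := by
  have e : ∀ s ∈ Ioi r, ((n + α) * s ^ (-(n + α) - 1)) * (V * s ^ n - V * r ^ n)
      = ((n + α) * V) * s ^ (-α - 1) - ((n + α) * V * r ^ n) * s ^ (-(n + α) - 1) := by
    intro s hs
    have hs0 : 0 < s := hr.trans hs
    have : s ^ (-α - 1) = s ^ (-(n + α) - 1) * s ^ n := by
      rw [← Real.rpow_natCast, ← Real.rpow_add hs0]; congr 1; ring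
    rw [this]; ring
  have hn0 : (0:ℝ) < n := by exact_mod_cast hn
  rw [setIntegral_congr_fun measurableSet_Ioi e, integral_sub, integral_const_mul,
    integral_const_mul, integral_Ioi_rpow_of_lt (by linarith) hr,
    integral_Ioi_rpow_of_lt (by linarith) hr, sub_add_cancel, sub_add_cancel]
  · have : r ^ (-α) = r ^ (-(n + α)) * r ^ n := by
      rw [← Real.rpow_natCast, ← Real.rpow_add hr]; congr 1; ring
    rw [this]
    have : (n:ℝ) + α ≠ 0 := by positivity
    field_simp
    ring
  · exact (integrableOn_Ioi_rpow_of_lt (by linarith) hr).const_mul _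
  · exact (integrableOn_Ioi_rpow_of_lt (by linarith) hr).const_mul _

open scoped Pointwise in
lemma aux_inner (n : ℕ) (hn : 1 ≤ n) (α : ℝ) (hα0 : 0 < α)
    (K : Set (EuclideanSpace ℝ (Fin n))) (hK₁ : IsCompact K) (hK₂ : Convex ℝ K)
    (h0 : (0 : EuclideanSpace ℝ (Fin n)) ∈ interior K)
    (E : Set (EuclideanSpace ℝ (Fin n))) (hE : MeasurableSet E) (V r : ℝ) (hV0 : 0 < V) (hr : 0 < r)
    (hV : volume K = ENNReal.ofReal V) (hW : volume E = ENNReal.ofReal (V * r ^ n))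
    (x : EuclideanSpace ℝ (Fin n)) :
    ENNReal.ofReal (V * n / α * r ^ (-α)) ≤
      ∫⁻ y in Eᶜ, ENNReal.ofReal (1 / gauge K (x - y) ^ ((n : ℝ) + α)) := by
  have : Nonempty (Fin n) := ⟨⟨0, hn⟩⟩
  have hn0 : (0:ℝ) < n := by exact_mod_cast hn
  have hgc := aux_gauge_cont hK₂ h0
  have hp : 0 < (n:ℝ) + α := by positivity
  have h1 : ∫⁻ y in Eᶜ, ENNReal.ofReal (1 / gauge K (x - y) ^ ((n : ℝ) + α)) =
      ∫⁻ y in Eᶜ, ∫⁻ s in Ioi (0:ℝ), {s : ℝ | gauge K (x - y) ≤ s}.indicator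
        (fun s => ENNReal.ofReal (((n:ℝ) + α) * s ^ (-((n:ℝ) + α) - 1))) s := by
    apply lintegral_congr_ae
    apply ae_restrict_of_ae
    have : ∀ᵐ y : EuclideanSpace ℝ (Fin n), y ≠ x := by
      simp [ae_iff]
    filter_upwards [this] with y hy
    apply aux_kernel _ _ hp
    rw [gauge_pos (absorbent_nhds_zero (mem_interior_iff_mem_nhds.1 h0))
      (hK₁.isVonNBounded ℝ)]
    exact sub_ne_zero.2 hy.symm
  have hm : MeasurableSet {q : EuclideanSpace ℝ (Fin n) × ℝ | gauge K (x - q.1) ≤ q.2} :=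
    (isClosed_le (by fun_prop) (by fun_prop)).measurableSet
  have hmeas : Measurable (fun q : EuclideanSpace ℝ (Fin n) × ℝ =>
      {s : ℝ | gauge K (x - q.1) ≤ s}.indicator
        (fun s => ENNReal.ofReal (((n:ℝ) + α) * s ^ (-((n:ℝ) + α) - 1))) q.2) := by
    have : Measurable (fun q : EuclideanSpace ℝ (Fin n) × ℝ => 
      ENNReal.ofReal (((n:ℝ) + α) * q.2 ^ (-((n:ℝ) + α) - 1))) := by fun_prop
    exact this.indicator hm
  rw [h1, lintegral_lintegral_swap hmeas.aemeasurable, aux_int n hn α V r hα0 hr]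
  calc ENNReal.ofReal _ ≤ ∫⁻ s in Ioi r, ENNReal.ofReal
        (((n + α) * s ^ (-(n + α) - 1)) * (V * s ^ n - V * r ^ n)) := by
          refine (Real.ofReal_le_enorm _).trans ((enorm_integral_le_lintegral_enorm _).trans ?_)
          apply setLIntegral_mono_ae' measurableSet_Ioi
          refine Filter.Eventually.of_forall fun s hs => ?_
          have hs0 : 0 < s := hr.trans hs
          have hs1 : r ^ n ≤ s ^ n := pow_le_pow_left₀ hr.le (le_of_lt hs) n
          rw [Real.enorm_of_nonneg]
          refine mul_nonneg (by positivity) (sub_nonneg.2 (by gcongr))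
    _ ≤ ∫⁻ s in Ioi r, ∫⁻ y in Eᶜ, {s : ℝ | gauge K (x - y) ≤ s}.indicator
        (fun s => ENNReal.ofReal (((n:ℝ) + α) * s ^ (-((n:ℝ) + α) - 1))) s := by
      apply setLIntegral_mono_ae' measurableSet_Ioi
      refine Filter.Eventually.of_forall fun s hs => ?_
      have hs0 : 0 < s := hr.trans hs
      have hms : MeasurableSet {y : EuclideanSpace ℝ (Fin n) | gauge K (x - y) ≤ s} :=
        (isClosed_le (by fun_prop) (by fun_prop)).measurableSet
      have : (fun y => {s : ℝ | gauge K (x - y) ≤ s}.indicator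
        (fun s => ENNReal.ofReal (((n:ℝ) + α) * s ^ (-((n:ℝ) + α) - 1))) s)
        = {y : EuclideanSpace ℝ (Fin n) | gauge K (x - y) ≤ s}.indicator
          (fun _ => ENNReal.ofReal (((n:ℝ) + α) * s ^ (-((n:ℝ) + α) - 1))) := by
        ext y; simp [indicator]
      rw [this, lintegral_indicator_const hms, Measure.restrict_apply hms,
        ENNReal.ofReal_mul (by positivity)]
      gcongr
      have hsub : (fun y => x - y) ⁻¹' (s • K) ⊆ {y | gauge K (x - y) ≤ s} := by
        intro y hy
        exact gauge_le_of_mem hs0.le hy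
      have hvol : volume ((fun y => x - y) ⁻¹' (s • K)) = ENNReal.ofReal (V * s ^ n) := by
        rw [(Measure.measurePreserving_sub_left volume x).measure_preimage
          (hK₁.smul s).measurableSet.nullMeasurableSet, Measure.addHaar_smul, hV,
          finrank_euclideanSpace, Fintype.card_fin, abs_of_pos (by positivity),
          ← ENNReal.ofReal_mul (by positivity), mul_comm]
      rw [ENNReal.ofReal_sub _ (by positivity), ← hW, ← hvol, ← Set.sdiff_eq]
      exact (tsub_le_tsub_right (measure_mono hsub) _).trans le_measure_sdiff
    _ ≤ _ := lintegral_mono_set (Ioi_subset_Ioi hr.le)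

lemma aux_per (n : ℕ) (hn : 1 ≤ n) (α : ℝ) (hα0 : 0 < α) (hα1 : α < 1)
    (K : Set (EuclideanSpace ℝ (Fin n))) (hK₁ : IsCompact K) (hK₂ : Convex ℝ K)
    (h0 : (0 : EuclideanSpace ℝ (Fin n)) ∈ interior K)
    (E : Set (EuclideanSpace ℝ (Fin n))) (hE : MeasurableSet E) (hEf : volume E ≠ ⊤) :
    (n : ℝ≥0∞) * volume K ^ (((n : ℝ) + α) / n) * volume E ^ (((n : ℝ) - α) / n) ≤ 
      ENNReal.ofReal α * fracPerim n α E K := by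
  have hn1 : (1:ℝ) ≤ n := by exact_mod_cast hn
  have hn0 : (0:ℝ) < n := by linarith
  have hKpos : 0 < volume K := 
    (isOpen_interior.measure_pos volume ⟨0, h0⟩).trans_le (measure_mono interior_subset)
  have hKf : volume K ≠ ⊤ := hK₁.measure_lt_top.ne
  rcases eq_or_ne (volume E) 0 with hz | hz
  · rw [hz, ENNReal.zero_rpow_of_pos (div_pos (by linarith) hn0)]; simp
  set V := (volume K).toReal with hVd
  set W := (volume E).toReal with hWd
  have hV0 : 0 < V := ENNReal.toReal_pos hKpos.ne' hKf
  have hW0 : 0 < W := ENNReal.toReal_pos hz hEf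
  have hV : volume K = ENNReal.ofReal V := (ENNReal.ofReal_toReal hKf).symm
  have hWv : volume E = ENNReal.ofReal W := (ENNReal.ofReal_toReal hEf).symm
  set r := (W / V) ^ (1 / (n:ℝ)) with hrd
  have hr : 0 < r := by positivity
  have hrn : V * r ^ n = W := by
    rw [hrd, ← Real.rpow_natCast, ← Real.rpow_mul (by positivity), one_div_mul_cancel hn0.ne',
      Real.rpow_one]
    field_simp
  have key := aux_inner n hn α hα0 K hK₁ hK₂ h0 E hE V r hV0 hr hV (by rw [hrn, hWv])
  calc _ = ENNReal.ofReal α * (ENNReal.ofReal (V * n / α * r ^ (-α)) * volume E) := by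
        rw [hV, hWv, ENNReal.ofReal_rpow_of_pos hV0, ENNReal.ofReal_rpow_of_pos hW0,
          ← ENNReal.ofReal_natCast, ← ENNReal.ofReal_mul (by positivity),
          ← ENNReal.ofReal_mul (by positivity), ← ENNReal.ofReal_mul (by positivity),
          ← ENNReal.ofReal_mul (by positivity)]
        congr 1
        have e1 : ((n:ℝ) + α) / n = 1 + α / n := by field_simp
        have e2 : ((n:ℝ) - α) / n = 1 - α / n := by field_simp
        have e3 : r ^ (-α) = V ^ (α / n) / W ^ (α / n) := by
          rw [hrd, ← Real.rpow_mul (by positivity), Real.div_rpow hW0.le hV0.le,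
            show 1 / (n:ℝ) * -α = -(α / n) by ring, Real.rpow_neg hW0.le, Real.rpow_neg hV0.le]
          field_simp
        rw [e1, e2, e3, Real.rpow_add hV0, Real.rpow_sub hW0, Real.rpow_one, Real.rpow_one]
        field_simp
    _ ≤ _ := by
        gcongr
        rw [fracPerim, ← setLIntegral_const]
        exact lintegral_mono fun x => key x

lemma aux_coarea (n : ℕ) (α : ℝ)
    (K : Set (EuclideanSpace ℝ (Fin n))) (hK₂ : Convex ℝ K) (hK₄ : K = -K)
    (h0 : (0 : EuclideanSpace ℝ (Fin n)) ∈ interior K)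
    (f : EuclideanSpace ℝ (Fin n) → ℝ) (hf : Continuous f) :
    sobNorm n α K f = 2 * ∫⁻ t : ℝ, fracPerim n α {x | t ≤ f x} K := by
  have hgc := aux_gauge_cont hK₂ h0
  have hgm : Measurable (gauge K) := hgc.measurable
  have hfm := hf.measurable
  set k : EuclideanSpace ℝ (Fin n) → ℝ≥0∞ :=
    fun z => ENNReal.ofReal (1 / gauge K z ^ ((n : ℝ) + α)) with hk
  have hkm : Measurable k := by fun_prop
  have hke : ∀ x y, k (x - y) = k (y - x) := by
    intro x y
    simp only [hk]
    rw [← gauge_neg (fun z hz => by rw [hK₄]; simpa using hz) (y - x), neg_sub]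
  set G : EuclideanSpace ℝ (Fin n) → EuclideanSpace ℝ (Fin n) → ℝ≥0∞ :=
    fun x y => ENNReal.ofReal (f x - f y) * k (x - y) with hG
  have hGm : Measurable (Function.uncurry G) := by
    simp only [hG]; unfold Function.uncurry; fun_prop
  have hGm2 : ∀ x, Measurable (G x) := fun x => hGm.of_uncurry_left
  have h1 : sobNorm n α K f = 2 * ∫⁻ x, ∫⁻ y, G x y := by
    have : ∀ x y, ENNReal.ofReal (|f x - f y| / gauge K (x - y) ^ ((n : ℝ) + α)) =
        G x y + G y x := by
      intro x y
      simp only [hG]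
      rw [hke y x, ← add_mul, div_eq_mul_one_div, ENNReal.ofReal_mul (abs_nonneg _)]
      congr 1
      rcases le_total (f x) (f y) with h | h
      · rw [abs_of_nonpos (by linarith), ENNReal.ofReal_of_nonpos (p := f x - f y) (by linarith)]
        simp
      · rw [abs_of_nonneg (by linarith), ENNReal.ofReal_of_nonpos (p := f y - f x) (by linarith)]
        simp
    simp only [sobNorm, this]
    rw [lintegral_congr fun x => lintegral_add_left (hGm2 x) _,
      lintegral_add_left (f := fun x => ∫⁻ y, G x y) hGm.lintegral_prod_right', two_mul]
    congr 1
    exact (lintegral_lintegral_swap hGm.aemeasurable).symm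
  rw [h1]
  congr 1
  have hset : MeasurableSet {q : (EuclideanSpace ℝ (Fin n) × EuclideanSpace ℝ (Fin n)) × ℝ |
      f q.1.2 < q.2 ∧ q.2 ≤ f q.1.1} :=
    MeasurableSet.inter (s₁ := {q : (EuclideanSpace ℝ (Fin n) × EuclideanSpace ℝ (Fin n)) × ℝ |
      f q.1.2 < q.2}) (s₂ := {q | q.2 ≤ f q.1.1})
      (measurableSet_lt (by fun_prop) (by fun_prop))
      (measurableSet_le (by fun_prop) (by fun_prop))
  have hHm : Measurable (fun q : (EuclideanSpace ℝ (Fin n) × EuclideanSpace ℝ (Fin n)) × ℝ =>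
      (Ioc (f q.1.2) (f q.1.1)).indicator (fun _ => k (q.1.1 - q.1.2)) q.2) := by
    have : Measurable (fun q : (EuclideanSpace ℝ (Fin n) × EuclideanSpace ℝ (Fin n)) × ℝ =>
      k (q.1.1 - q.1.2)) := by fun_prop
    exact this.indicator hset
  have h2 : ∀ x y, G x y = ∫⁻ t : ℝ, (Ioc (f y) (f x)).indicator (fun _ => k (x - y)) t := by
    intro x y
    rw [lintegral_indicator_const measurableSet_Ioc, Real.volume_Ioc, mul_comm]
  simp only [h2]
  have h3 : ∀ x, ∫⁻ y, ∫⁻ t : ℝ, (Ioc (f y) (f x)).indicator (fun _ => k (x - y)) t =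
      ∫⁻ t : ℝ, ∫⁻ y, (Ioc (f y) (f x)).indicator (fun _ => k (x - y)) t := by
    intro x
    apply lintegral_lintegral_swap
    exact (hHm.comp (f := fun q : EuclideanSpace ℝ (Fin n) × ℝ => ((x, q.1), q.2))
      (by fun_prop)).aemeasurable
  simp only [h3]
  rw [lintegral_lintegral_swap]
  · apply lintegral_congr
    intro t
    have hmt : MeasurableSet {x | t ≤ f x} := measurableSet_le (by fun_prop) hfm
    rw [fracPerim, ← lintegral_indicator hmt]
    apply lintegral_congr
    intro x
    by_cases hx : t ≤ f x
    · rw [indicator_of_mem (by exact hx), ← lintegral_indicator hmt.compl]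
      apply lintegral_congr
      intro y
      simp [indicator, hx, hk]
    · rw [indicator_of_notMem (by exact hx)]
      simp [indicator, hx]
  · have := Measurable.lintegral_prod_right' (ν := (volume : Measure (EuclideanSpace ℝ (Fin n))))
      (hHm.comp (f := fun q : (EuclideanSpace ℝ (Fin n) × ℝ) × EuclideanSpace ℝ (Fin n) =>
      ((q.1.1, q.2), q.1.2)) (by fun_prop))
    exact this.aemeasurable

theorem stmt14 (n : ℕ) (hn : 1 ≤ n) (α : ℝ) (hα0 : 0 < α) (hα1 : α < 1)
    (K : Set (EuclideanSpace ℝ (Fin n))) (hK₁ : IsCompact K) (hK₂ : Convex ℝ K)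
    (hK₃ : (interior K).Nonempty) (hK₄ : K = -K)
    (L : Set (EuclideanSpace ℝ (Fin n))) (hL : IsCompact L) :
    ENNReal.ofReal α * capCompact n α K L ≥
      2 * (n : ℝ≥0∞) * volume K ^ (((n : ℝ) + α) / n) * volume L ^ (((n : ℝ) - α) / n) := by
  have hn1 : (1:ℝ) ≤ n := by exact_mod_cast hn
  have h0 := aux_zero_mem hK₂ hK₃ hK₄
  set C := (n : ℝ≥0∞) * volume K ^ (((n : ℝ) + α) / n) * volume L ^ (((n : ℝ) - α) / n) with hC
  have hα : ENNReal.ofReal α ≠ 0 := by simpa using hα0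
  have hαt : ENNReal.ofReal α ≠ ⊤ := ENNReal.ofReal_ne_top
  rw [ge_iff_le, show 2 * (n : ℝ≥0∞) * volume K ^ (((n : ℝ) + α) / n) *
    volume L ^ (((n : ℝ) - α) / n) = 2 * C by rw [hC]; ring, mul_comm (ENNReal.ofReal α),
    ← ENNReal.div_le_iff hα hαt, capCompact]
  refine le_iInf₂ fun f hf => ?_
  obtain ⟨hfs, hfc, hfL⟩ := hf
  rw [ENNReal.div_le_iff hα hαt, aux_coarea n α K hK₂ hK₄ h0 f hfs.continuous, mul_assoc]
  gcongr
  calc C = ∫⁻ t in Ioc (0:ℝ) 1, C := by simp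
    _ ≤ ∫⁻ t in Ioc (0:ℝ) 1, ENNReal.ofReal α * fracPerim n α {x | t ≤ f x} K := by
      apply setLIntegral_mono_ae' measurableSet_Ioc
      refine Filter.Eventually.of_forall fun t ht => ?_
      have hsubL : L ⊆ {x | t ≤ f x} := by
        intro x hx
        have := hfL x
        rw [indicator_of_mem hx] at this
        exact ht.2.trans this
      have hsupp : {x | t ≤ f x} ⊆ tsupport f := by
        intro x hx
        apply subset_tsupport
        exact (ht.1.trans_le hx).ne'
      refine le_trans ?_ (aux_per n hn α hα0 hα1 K hK₁ hK₂ h0 {x | t ≤ f x}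
        (isClosed_le continuous_const hfs.continuous).measurableSet
        ((measure_mono hsupp).trans_lt hfc.measure_lt_top).ne)
      rw [hC]
      gcongr
      exact div_nonneg (by linarith) (by linarith)
    _ ≤ ∫⁻ t : ℝ, ENNReal.ofReal α * fracPerim n α {x | t ≤ f x} K :=
      setLIntegral_le_lintegral _ _
    _ = _ := by rw [lintegral_const_mul' _ _ hαt, mul_comm]
end

section
/- Let $0<\alpha<1$, $K\subset\mathbb{R}^n$ an origin-symmetric convex body, and $L\subset\mathbb{R}^n$ compact. Then $\mathrm{cap}(L;\dot\Lambda^{1,1}_{\alpha,K}) \ge 2\inf_{O\in\mathcal{O}^\infty(L)} P_\alpha(O,K)$, where $\mathcal{O}^\infty(L)$ is the class of all bounded open sets with $C^\infty$ boundary containing $L$. -/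
open MeasureTheory Set
open scoped ENNReal

section Coarea
variable {E : Type*} [MeasurableSpace E] [AddGroup E] [MeasurableSub₂ E]

lemma coarea_aux (μ : Measure E) [SFinite μ] (f : E → ℝ) (hf : Measurable f) (k : E → ℝ≥0∞)
    (hk : Measurable k) (hke : ∀ x, k (-x) = k x) :
    ∫⁻ t : ℝ, 2 * ∫⁻ x in {x | t < f x}, ∫⁻ y in {x | t < f x}ᶜ, k (x - y) ∂μ ∂μ
      = ∫⁻ x, ∫⁻ y, ENNReal.ofReal |f x - f y| * k (x - y) ∂μ ∂μ := by
  set A : ℝ → E → E → ℝ≥0∞ := fun t x y => (Ico (f y) (f x)).indicator 1 t * k (x - y) with hA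
  have hkm : Measurable (fun p : E × E => k (p.1 - p.2)) := by fun_prop
  have hAm : Measurable (fun p : ℝ × E × E => A p.1 p.2.1 p.2.2) := by
    have h1 : Measurable (fun p : ℝ × E × E => (Ico (f p.2.2) (f p.2.1)).indicator (1 : ℝ → ℝ≥0∞) p.1) := by
      have : (fun p : ℝ × E × E => (Ico (f p.2.2) (f p.2.1)).indicator (1 : ℝ → ℝ≥0∞) p.1)
          = ({p : ℝ × E × E | f p.2.2 ≤ p.1} ∩ {p : ℝ × E × E | p.1 < f p.2.1}).indicator 1 := by
        ext p
        simp [Set.indicator, Set.mem_Ico]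
      rw [this]
      apply Measurable.indicator measurable_one
      apply MeasurableSet.inter
      · exact measurableSet_le (by fun_prop) (by fun_prop)
      · exact measurableSet_lt (by fun_prop) (by fun_prop)
    exact h1.mul (by fun_prop)
  have hP : ∀ t, ∫⁻ x in {x | t < f x}, ∫⁻ y in {x | t < f x}ᶜ, k (x - y) ∂μ ∂μ
      = ∫⁻ x, ∫⁻ y, A t x y ∂μ ∂μ := by
    intro t
    have hm : MeasurableSet {x | t < f x} := measurableSet_lt measurable_const hf
    rw [← lintegral_indicator hm]
    congr 1; ext x
    by_cases hx : t < f x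
    · rw [Set.indicator_of_mem (by exact hx), ← lintegral_indicator hm.compl]
      congr 1; ext y
      by_cases hy : t < f y
      · simp [hA, hy]
      · simp [hA, hy, hx, not_lt.1 hy]
    · simp [hx, hA]
  have hP2 : ∀ t, ∫⁻ x, ∫⁻ y, A t x y ∂μ ∂μ = ∫⁻ x, ∫⁻ y, A t y x ∂μ ∂μ := by
    intro t
    apply lintegral_lintegral_swap
    have : Measurable (fun p : E × E => A t p.1 p.2) :=
      hAm.comp (measurable_const.prodMk measurable_id)
    exact this.aemeasurable
  have h2 : ∀ t, 2 * ∫⁻ x, ∫⁻ y, A t x y ∂μ ∂μ = ∫⁻ x, ∫⁻ y, (A t x y + A t y x) ∂μ ∂μ := by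
    intro t
    have m1 : Measurable (fun p : E × E => A t p.1 p.2) :=
      hAm.comp (measurable_const.prodMk measurable_id)
    rw [two_mul]
    nth_rewrite 2 [hP2 t]
    rw [← lintegral_add_left (by exact m1.lintegral_prod_right')]
    congr 1; ext x
    rw [lintegral_add_left]
    exact m1.comp (measurable_const.prodMk measurable_id)
  simp_rw [hP, h2]
  have hBm : Measurable (fun p : ℝ × E × E => A p.1 p.2.1 p.2.2 + A p.1 p.2.2 p.2.1) := by
    apply hAm.add
    exact hAm.comp (measurable_fst.prodMk ((measurable_snd.comp measurable_snd).prodMk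
      (measurable_fst.comp measurable_snd)))
  rw [lintegral_lintegral_swap]
  · congr 1; ext x
    rw [lintegral_lintegral_swap]
    · congr 1; ext y
      have hkk : k (y - x) = k (x - y) := by rw [← hke (x - y), neg_sub]
      have m0 : ∀ a b : ℝ, Measurable ((Ico a b).indicator (1 : ℝ → ℝ≥0∞)) :=
        fun a b => measurable_one.indicator measurableSet_Ico
      simp only [hA, hkk, ← add_mul]
      rw [lintegral_mul_const _ (by exact (m0 _ _).add (m0 _ _)), lintegral_add_left (m0 _ _),
        lintegral_indicator_one measurableSet_Ico, lintegral_indicator_one measurableSet_Ico,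
        Real.volume_Ico, Real.volume_Ico]
      congr 1
      rcases le_total (f x) (f y) with h | h
      · rw [ENNReal.ofReal_of_nonpos (by linarith), zero_add, abs_of_nonpos (by linarith), neg_sub]
      · rw [ENNReal.ofReal_of_nonpos (p := f y - f x) (by linarith), add_zero, abs_of_nonneg (by linarith)]
    · have : Measurable (fun p : ℝ × E => (fun p : ℝ × E × E => A p.1 p.2.1 p.2.2 + A p.1 p.2.2 p.2.1) (p.1, x, p.2)) := hBm.comp (by fun_prop)
      exact this.aemeasurable
  · apply Measurable.aemeasurable
    have : Measurable (fun q : (ℝ × E) × E => (fun p : ℝ × E × E => A p.1 p.2.1 p.2.2 + A p.1 p.2.2 p.2.1) (q.1.1, q.1.2, q.2)) := hBm.comp (by fun_prop)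
    exact this.lintegral_prod_right'
end Coarea

lemma kernel_int {E : Type*} [NormedAddCommGroup E] [NormedSpace ℝ E] [FiniteDimensional ℝ E]
    [MeasurableSpace E] [BorelSpace E] [Nontrivial E] (μ : Measure E) [μ.IsAddHaarMeasure]
    (α : ℝ) (hα0 : 0 < α) (hα1 : α < 1) :
    ∫⁻ h, ENNReal.ofReal (min ‖h‖ 1 / ‖h‖ ^ ((Module.finrank ℝ E : ℝ) + α)) ∂μ < ∞ := by
  set d := Module.finrank ℝ E with hd
  have hdpos : 0 < d := Module.finrank_pos
  have key : Integrable (fun h : E => (fun r : ℝ => min r 1 / r ^ ((d : ℝ) + α)) ‖h‖) μ := by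
    refine (integrable_fun_norm_addHaar μ (f := fun r : ℝ => min r 1 / r ^ ((d : ℝ) + α))).2 ?_
    rw [← Ioc_union_Ioi_eq_Ioi (zero_le_one (α := ℝ)), integrableOn_union]
    constructor
    · have : IntegrableOn (fun r : ℝ => r ^ (-α)) (Ioc 0 1) := by
        rw [integrableOn_Ioc_iff_integrableOn_Ioo, intervalIntegral.integrableOn_Ioo_rpow_iff zero_lt_one]
        linarith
      refine this.congr_fun ?_ measurableSet_Ioc
      intro r hr
      have hr0 : 0 < r := hr.1
      simp only [min_eq_left hr.2, smul_eq_mul]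
      rw [Real.rpow_neg hr0.le, Real.rpow_add hr0, Real.rpow_natCast]
      have : r ^ d = r ^ (d - 1) * r := by rw [← pow_succ]; congr 1; omega
      rw [← hd, this]
      have := Real.rpow_pos_of_pos hr0 α
      field_simp
    · have : IntegrableOn (fun r : ℝ => r ^ (-1-α)) (Ioi 1) :=
        integrableOn_Ioi_rpow_of_lt (by linarith) zero_lt_one
      refine this.congr_fun ?_ measurableSet_Ioi
      intro r hr
      have hr1 : 1 < r := hr
      have hr0 : 0 < r := by linarith
      simp only [min_eq_right hr1.le, smul_eq_mul]
      rw [sub_eq_add_neg, Real.rpow_add hr0, Real.rpow_neg hr0.le, Real.rpow_neg hr0.le, Real.rpow_add hr0, Real.rpow_natCast, Real.rpow_one]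
      have : r ^ d = r ^ (d - 1) * r := by rw [← pow_succ]; congr 1; omega
      rw [← hd, this]
      have := Real.rpow_pos_of_pos hr0 α
      field_simp
  exact key.lintegral_lt_top

lemma finite_norm {E F : Type*} [NormedAddCommGroup E] [NormedSpace ℝ E] [FiniteDimensional ℝ E]
    [MeasurableSpace E] [BorelSpace E] [Nontrivial E] (μ : Measure E) [μ.IsAddHaarMeasure]
    [NormedAddCommGroup F] [NormedSpace ℝ F] (k : E → ℝ≥0∞) (hk : Measurable k)
    (hke : ∀ x, k (-x) = k x)
    (hkf : ∫⁻ h, ENNReal.ofReal (min ‖h‖ 1) * k h ∂μ < ∞)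
    (G : E → F) (hG : ContDiff ℝ 1 G) (hGc : HasCompactSupport G) :
    ∫⁻ x, ∫⁻ y, ENNReal.ofReal ‖G x - G y‖ * k (x - y) ∂μ ∂μ < ∞ := by
  obtain ⟨C, hC⟩ := ContDiff.lipschitzWith_of_hasCompactSupport (𝕂 := ℝ) hGc hG (by simp)
  obtain ⟨B, hB⟩ := hGc.exists_bound_of_continuous hG.continuous
  have hB0 : 0 ≤ B := (norm_nonneg _).trans (hB 0)
  set M : ℝ := C + 2 * B with hM
  have hM0 : 0 ≤ M := by positivity
  set S := tsupport G with hS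
  have hSm : MeasurableSet S := (isClosed_tsupport G).measurableSet
  have hSf : μ S < ∞ := hGc.isCompact.measure_lt_top
  set φ : E → ℝ≥0∞ := fun h => ENNReal.ofReal (min ‖h‖ 1) * k h with hφ
  have hφm : Measurable φ := by fun_prop
  have hφe : ∀ x y, φ (y - x) = φ (x - y) := by
    intro x y; simp only [hφ]; rw [norm_sub_rev, ← hke (x - y), neg_sub]
  have hpt : ∀ x y, ENNReal.ofReal ‖G x - G y‖ * k (x - y) ≤
      ENNReal.ofReal M * (S.indicator 1 x * φ (x - y) + S.indicator 1 y * φ (x - y)) := by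
    intro x y
    have h1 : ‖G x - G y‖ ≤ M * min ‖x - y‖ 1 := by
      have a1 : ‖G x - G y‖ ≤ C * ‖x - y‖ := hC.norm_sub_le x y
      have a2 : ‖G x - G y‖ ≤ 2 * B := by
        have := norm_sub_le (G x) (G y); linarith [hB x, hB y]
      have hC0 : (0 : ℝ) ≤ C := C.2
      rcases le_total ‖x - y‖ 1 with h | h
      · rw [min_eq_left h]; nlinarith [norm_nonneg (x - y)]
      · rw [min_eq_right h]; linarith
    have h2 : ENNReal.ofReal ‖G x - G y‖ * k (x - y) ≤ ENNReal.ofReal M * φ (x - y) := by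
      simp only [hφ]
      rw [← mul_assoc, ← ENNReal.ofReal_mul hM0]
      gcongr
    by_cases hx : x ∈ S
    · refine h2.trans ?_
      gcongr
      simp [hx]
    by_cases hy : y ∈ S
    · refine h2.trans ?_
      gcongr
      simp [hy]
    · have e1 := image_eq_zero_of_notMem_tsupport hx
      have e2 := image_eq_zero_of_notMem_tsupport hy
      simp [e1, e2]
  have hind : Measurable (S.indicator (1 : E → ℝ≥0∞)) := measurable_one.indicator hSm
  have m1 : Measurable (fun p : E × E => S.indicator 1 p.1 * φ (p.1 - p.2)) := by fun_prop
  have m2 : Measurable (fun p : E × E => S.indicator 1 p.2 * φ (p.1 - p.2)) := by fun_prop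
  have i1 : ∀ x, ∫⁻ y, S.indicator 1 x * φ (x - y) ∂μ = S.indicator 1 x * ∫⁻ h, φ h ∂μ := by
    intro x
    rw [lintegral_const_mul _ (by fun_prop), lintegral_sub_left_eq_self]
  have I1 : ∫⁻ x, ∫⁻ y, S.indicator 1 x * φ (x - y) ∂μ ∂μ = μ S * ∫⁻ h, φ h ∂μ := by
    simp_rw [i1]
    rw [lintegral_mul_const _ hind, lintegral_indicator_one hSm]
  have I2 : ∫⁻ x, ∫⁻ y, S.indicator 1 y * φ (x - y) ∂μ ∂μ = μ S * ∫⁻ h, φ h ∂μ := by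
    rw [lintegral_lintegral_swap m2.aemeasurable, ← I1]
    simp_rw [hφe]
  calc _ ≤ ∫⁻ x, ∫⁻ y, ENNReal.ofReal M * (S.indicator 1 x * φ (x - y) + S.indicator 1 y * φ (x - y)) ∂μ ∂μ :=
        lintegral_mono fun x => lintegral_mono fun y => hpt x y
    _ = ENNReal.ofReal M * (μ S * ∫⁻ h, φ h ∂μ + μ S * ∫⁻ h, φ h ∂μ) := by
        nth_rewrite 1 [← I1]
        rw [← I2, ← lintegral_add_left (by exact m1.lintegral_prod_right'), ← lintegral_const_mul' _ _ ENNReal.ofReal_ne_top]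
        congr 1; ext x
        rw [lintegral_const_mul' _ _ ENNReal.ofReal_ne_top, lintegral_add_left]
        exact m1.comp (measurable_const.prodMk measurable_id)
    _ < ∞ := by
        have : μ S * ∫⁻ h, φ h ∂μ < ∞ := ENNReal.mul_lt_top hSf hkf
        exact ENNReal.mul_lt_top ENNReal.ofReal_lt_top (ENNReal.add_lt_top.2 ⟨this, this⟩)

lemma morse_aux {E : Type*} [NormedAddCommGroup E] [InnerProductSpace ℝ E] [FiniteDimensional ℝ E]
    [MeasurableSpace E] [BorelSpace E] (μ : Measure E) [μ.IsAddHaarMeasure]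
    (f : E → ℝ) (hf : ContDiff ℝ 2 f) :
    ∀ᵐ a ∂μ, {x | fderiv ℝ f x + innerSL ℝ a = 0}.Countable := by
  let e := (InnerProductSpace.toDual ℝ E).symm
  set Φ : E → E := fun x => - e (fderiv ℝ f x) with hΦ
  have hΦd : Differentiable ℝ Φ := by
    have h1 : Differentiable ℝ (fderiv ℝ f) :=
      (hf.fderiv_right (m := 1) (by norm_num)).differentiable (by norm_num)
    have h2 : Differentiable ℝ (fun x => e (fderiv ℝ f x)) :=
      e.toContinuousLinearEquiv.differentiable.comp h1
    exact h2.neg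
  have hnull : μ (Φ '' {x | (fderiv ℝ Φ x).det = 0}) = 0 :=
    addHaar_image_eq_zero_of_det_fderivWithin_eq_zero μ
      (fun x _ => (hΦd x).hasFDerivAt.hasFDerivWithinAt) (fun x hx => hx)
  rw [← compl_mem_ae_iff] at hnull
  filter_upwards [hnull] with a ha
  have hsub : {x | fderiv ℝ f x + innerSL ℝ a = 0} ⊆ Φ ⁻¹' {a} := by
    intro x hx
    have h1 : fderiv ℝ f x = InnerProductSpace.toDual ℝ E (-a) := by
      rw [map_neg]
      exact eq_neg_of_add_eq_zero_left hx
    simp [hΦ, h1, e]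
  refine Set.Countable.mono hsub ?_
  refine (HereditarilyLindelofSpace.isLindelof _).countable_of_isDiscrete ?_
  rw [isDiscrete_iff_nhdsNE]
  intro x hx
  have hxa : Φ x = a := hx
  have hdet : (fderiv ℝ Φ x).det ≠ 0 := by
    intro h
    exact ha ⟨x, h, hxa⟩
  have hanti : ∃ C, AntilipschitzWith C (fderiv ℝ Φ x) := by
    refine ⟨_, (ContinuousLinearMap.toContinuousLinearEquivOfDetNeZero (fderiv ℝ Φ x) hdet).antilipschitz⟩
  have := (hΦd x).hasFDerivAt.eventually_ne (c := a) hanti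
  rw [← disjoint_iff, Filter.disjoint_principal_right]
  exact this

lemma perturb {E : Type*} [NormedAddCommGroup E] [InnerProductSpace ℝ E] [FiniteDimensional ℝ E]
    [MeasurableSpace E] [BorelSpace E] [Nontrivial E] (μ : Measure E) [μ.IsAddHaarMeasure]
    (k : E → ℝ≥0∞) (hk : Measurable k)
    (hke : ∀ x, k (-x) = k x)
    (hkf : ∫⁻ h, ENNReal.ofReal (min ‖h‖ 1) * k h ∂μ < ∞)
    (f : E → ℝ) (hf : ContDiff ℝ (⊤ : ℕ∞) f) (hfc : HasCompactSupport f) (ε : ℝ) (hε : 0 < ε) :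
    ∃ g : E → ℝ, ContDiff ℝ (⊤ : ℕ∞) g ∧ HasCompactSupport g ∧ (∀ x, |g x - f x| ≤ ε) ∧
      (∀ᵐ t : ℝ, ε < t → ∀ x, g x = t → fderiv ℝ g x ≠ 0) ∧
      ∫⁻ x, ∫⁻ y, ENNReal.ofReal |g x - g y| * k (x - y) ∂μ ∂μ ≤
        ∫⁻ x, ∫⁻ y, ENNReal.ofReal |f x - f y| * k (x - y) ∂μ ∂μ + ENNReal.ofReal ε := by
  obtain ⟨R, hR0, hR⟩ : ∃ R : ℝ, 0 < R ∧ tsupport f ⊆ Metric.ball 0 R := by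
    obtain ⟨R, hR⟩ := hfc.isCompact.isBounded.subset_ball 0
    exact ⟨max R 1, by positivity, hR.trans (Metric.ball_subset_ball (le_max_left _ _))⟩
  let χ : ContDiffBump (0 : E) := ⟨R, R + 1, hR0, by linarith⟩
  let G : E → E := fun x => χ x • x
  have hG : ContDiff ℝ (⊤ : ℕ∞) G := χ.contDiff.smul contDiff_id
  have hGc : HasCompactSupport G := χ.hasCompactSupport.smul_right
  obtain ⟨B, hB⟩ := hGc.exists_bound_of_continuous hG.continuous
  have hB0 : 0 ≤ B := (norm_nonneg _).trans (hB 0)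
  have hN := finite_norm μ k hk hke hkf G (hG.of_le (by exact_mod_cast le_top)) hGc
  set N := ∫⁻ x, ∫⁻ y, ENNReal.ofReal ‖G x - G y‖ * k (x - y) ∂μ ∂μ with hNdef
  set δ : ℝ := ε / (1 + B + N.toReal) with hδ
  have hN0 : 0 ≤ N.toReal := ENNReal.toReal_nonneg
  have hδ0 : 0 < δ := by positivity
  have hδB : δ * B ≤ ε := by
    rw [hδ, div_mul_eq_mul_div, div_le_iff₀ (by positivity)]; nlinarith
  have hδN : δ * N.toReal ≤ ε := by
    rw [hδ, div_mul_eq_mul_div, div_le_iff₀ (by positivity)]; nlinarith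
  obtain ⟨a, haδ, hac⟩ := (Measure.dense_of_ae (morse_aux μ f (hf.of_le (by
      exact WithTop.coe_le_coe.2 (le_top : (2 : ℕ∞) ≤ ⊤))))).inter_open_nonempty
    (Metric.ball (0 : E) δ) Metric.isOpen_ball ⟨0, Metric.mem_ball_self hδ0⟩
  have haδ' : ‖a‖ ≤ δ := by simpa using (mem_ball_zero_iff.1 haδ).le
  have hac' : {x | fderiv ℝ f x + innerSL ℝ a = 0}.Countable := hac
  set g : E → ℝ := fun x => f x + innerSL ℝ a (G x) with hg
  have hsmall : ∀ x, |innerSL ℝ a (G x)| ≤ ε := by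
    intro x
    calc |innerSL ℝ a (G x)| ≤ ‖a‖ * ‖G x‖ := by
          simpa using abs_real_inner_le_norm a (G x)
      _ ≤ δ * B := by gcongr; exact hB x
      _ ≤ ε := hδB
  refine ⟨g, hf.add ((innerSL ℝ a).contDiff.comp hG), ?_, ?_, ?_, ?_⟩
  · exact hfc.add (hGc.comp_left (map_zero _))
  · intro x
    simp only [hg, add_sub_cancel_left]
    exact hsmall x
  · have hcount : (g '' {x | fderiv ℝ f x + innerSL ℝ a = 0}).Countable := hac'.image g
    have hnull := hcount.measure_zero volume
    rw [← compl_mem_ae_iff] at hnull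
    filter_upwards [hnull] with t ht htε x hx h0
    apply ht
    refine ⟨x, ?_, hx⟩
    have hfx : f x ≠ 0 := by
      intro h
      have := hsmall x
      simp only [hg, h, zero_add] at hx
      rw [hx] at this
      linarith [le_abs_self t]
    have hxR : x ∈ Metric.ball (0 : E) R := hR (subset_tsupport f hfx)
    have heq : g =ᶠ[nhds x] fun y => f y + innerSL ℝ a y := by
      filter_upwards [χ.eventuallyEq_one_of_mem_ball hxR] with y hy
      simp [hg, G, hy]
    rw [heq.fderiv_eq, fderiv_fun_add (hf.differentiable (by simp) x) (innerSL ℝ a).differentiableAt,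
      ContinuousLinearMap.fderiv] at h0
    exact h0
  · have hpt : ∀ x y, ENNReal.ofReal |g x - g y| * k (x - y) ≤
        ENNReal.ofReal |f x - f y| * k (x - y) +
          ENNReal.ofReal δ * (ENNReal.ofReal ‖G x - G y‖ * k (x - y)) := by
      intro x y
      rw [← mul_assoc, ← ENNReal.ofReal_mul hδ0.le, ← add_mul, ← ENNReal.ofReal_add (abs_nonneg _) (by positivity)]
      gcongr
      have e : g x - g y = (f x - f y) + innerSL ℝ a (G x - G y) := by
        simp only [hg, map_sub]; ring
      rw [e]
      refine (abs_add_le _ _).trans ?_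
      gcongr
      calc |innerSL ℝ a (G x - G y)| ≤ ‖a‖ * ‖G x - G y‖ := by
            simpa using abs_real_inner_le_norm a (G x - G y)
        _ ≤ _ := by gcongr
    have hfm : Measurable f := hf.continuous.measurable
    have m1 : Measurable (fun p : E × E => ENNReal.ofReal |f p.1 - f p.2| * k (p.1 - p.2)) := by
      have : Measurable (fun p : E × E => |f p.1 - f p.2|) := by fun_prop
      have h2 : Measurable (fun p : E × E => k (p.1 - p.2)) := by fun_prop
      exact this.ennreal_ofReal.mul h2
    calc _ ≤ ∫⁻ x, ∫⁻ y, (ENNReal.ofReal |f x - f y| * k (x - y) +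
          ENNReal.ofReal δ * (ENNReal.ofReal ‖G x - G y‖ * k (x - y))) ∂μ ∂μ :=
          lintegral_mono fun x => lintegral_mono fun y => hpt x y
      _ = ∫⁻ x, ∫⁻ y, ENNReal.ofReal |f x - f y| * k (x - y) ∂μ ∂μ + ENNReal.ofReal δ * N := by
          rw [hNdef, ← lintegral_const_mul' _ _ ENNReal.ofReal_ne_top,
            ← lintegral_add_left (by exact m1.lintegral_prod_right')]
          congr 1; ext x
          rw [← lintegral_const_mul' _ _ ENNReal.ofReal_ne_top, lintegral_add_left]
          exact m1.comp (measurable_const.prodMk measurable_id)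
      _ ≤ _ := by
          gcongr
          rw [← ENNReal.ofReal_toReal hN.ne, ← ENNReal.ofReal_mul hδ0.le]
          exact ENNReal.ofReal_le_ofReal hδN

lemma smooth_superlevel {n : ℕ} (g : EuclideanSpace ℝ (Fin n) → ℝ) (hg : ContDiff ℝ (⊤ : ℕ∞) g)
    (t : ℝ) (h : ∀ x, g x = t → fderiv ℝ g x ≠ 0) : SmoothBoundary {x | t < g x} := by
  intro x hx
  have hgx : g x = t := (frontier_lt_subset_eq continuous_const hg.continuous hx).symm
  refine ⟨{y | fderiv ℝ g y ≠ 0}, fun y => t - g y, ?_, h x hgx, contDiff_const.sub hg, ?_, ?_⟩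
  · exact isOpen_ne_fun (hg.continuous_fderiv (by simp)) continuous_const
  · intro y hy
    rw [fderiv_const_sub]
    exact neg_ne_zero.2 hy
  · ext y
    simp [and_comm]

theorem stmt15 (n : ℕ) (hn : 1 ≤ n) (α : ℝ) (hα0 : 0 < α) (hα1 : α < 1)
    (K : Set (EuclideanSpace ℝ (Fin n))) (hK₁ : IsCompact K) (hK₂ : Convex ℝ K)
    (hK₃ : (interior K).Nonempty) (hK₄ : K = -K)
    (L : Set (EuclideanSpace ℝ (Fin n))) (hL : IsCompact L) :
    capCompact n α K L ≥
      2 * ⨅ O ∈ {O : Set (EuclideanSpace ℝ (Fin n)) |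
          IsOpen O ∧ Bornology.IsBounded O ∧ SmoothBoundary O ∧ L ⊆ O},
        fracPerim n α O K := by
  have : Nonempty (Fin n) := ⟨⟨0, hn⟩⟩
  have hnt : Nontrivial (EuclideanSpace ℝ (Fin n)) := inferInstance
  have hsymm : ∀ x ∈ K, -x ∈ K := fun x hx => by rw [hK₄]; simpa using hx
  have h0 : K ∈ nhds (0 : (EuclideanSpace ℝ (Fin n))) := by
    obtain ⟨x, hx⟩ := hK₃
    have hx' : -x ∈ interior K := by
      rw [mem_interior_iff_mem_nhds] at hx ⊢
      have hc : Filter.Tendsto (fun y : (EuclideanSpace ℝ (Fin n)) => -y) (nhds (-x)) (nhds x) := by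
        simpa using (continuous_neg (G := (EuclideanSpace ℝ (Fin n)))).tendsto (-x)
      filter_upwards [hc hx] with y hy
      simpa using hsymm _ hy
    have := hK₂.interior hx hx' (a := 1/2) (b := 1/2) (by norm_num) (by norm_num) (by norm_num)
    rw [mem_interior_iff_mem_nhds] at this
    simpa using this
  have hgc : Continuous (gauge K) := continuous_gauge hK₂ h0
  set p : ℝ := (n : ℝ) + α with hp
  have hp0 : 0 < p := by positivity
  set k : (EuclideanSpace ℝ (Fin n)) → ℝ≥0∞ := fun h => ENNReal.ofReal (1 / gauge K h ^ p) with hkdef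
  have hk : Measurable k := by
    have := hgc.measurable
    fun_prop
  have hke : ∀ x, k (-x) = k x := fun x => by simp only [hkdef, gauge_neg hsymm]
  have hkf : ∫⁻ h, ENNReal.ofReal (min ‖h‖ 1) * k h < ∞ := by
    obtain ⟨r, hr0, hr⟩ : ∃ r : ℝ, 0 < r ∧ K ⊆ Metric.closedBall 0 r := by
      obtain ⟨r, hr⟩ := hK₁.isBounded.subset_closedBall 0
      exact ⟨max r 1, by positivity, hr.trans (Metric.closedBall_subset_closedBall (le_max_left _ _))⟩
    have hfin := kernel_int (volume : Measure (EuclideanSpace ℝ (Fin n))) α hα0 hα1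
    have hfr : (Module.finrank ℝ (EuclideanSpace ℝ (Fin n)) : ℝ) + α = p := by simp [hp]
    rw [hfr] at hfin
    calc _ ≤ ∫⁻ h : (EuclideanSpace ℝ (Fin n)), ENNReal.ofReal (r ^ p) * ENNReal.ofReal (min ‖h‖ 1 / ‖h‖ ^ p) := by
          apply lintegral_mono
          intro h
          simp only [hkdef]
          rw [← ENNReal.ofReal_mul (by positivity), ← ENNReal.ofReal_mul (by positivity)]
          apply ENNReal.ofReal_le_ofReal
          by_cases hh : h = 0
          · simp [hh]
          have hn0 : 0 < ‖h‖ := norm_pos_iff.2 hh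
          have hg : ‖h‖ / r ≤ gauge K h :=
            le_gauge_of_subset_closedBall (absorbent_nhds_zero h0) hr0.le hr
          have hg2 : (‖h‖ / r) ^ p ≤ gauge K h ^ p := Real.rpow_le_rpow (by positivity) hg hp0.le
          rw [Real.div_rpow hn0.le hr0.le] at hg2
          have q1 := Real.rpow_pos_of_pos hn0 p
          have q2 := Real.rpow_pos_of_pos hr0 p
          calc min ‖h‖ 1 * (1 / gauge K h ^ p) ≤ min ‖h‖ 1 * (1 / (‖h‖ ^ p / r ^ p)) := by
                gcongr
            _ = _ := by field_simp
      _ < ∞ := by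
          rw [lintegral_const_mul' _ _ ENNReal.ofReal_ne_top]
          exact ENNReal.mul_lt_top ENNReal.ofReal_lt_top hfin
  set I := ⨅ O ∈ {O : Set (EuclideanSpace ℝ (Fin n)) |
          IsOpen O ∧ Bornology.IsBounded O ∧ SmoothBoundary O ∧ L ⊆ O},
        fracPerim n α O K with hI
  change 2 * I ≤ capCompact n α K L
  unfold capCompact
  refine le_iInf₂ fun f hf => ?_
  obtain ⟨hf, hfc, hfL⟩ := hf
  have hS : sobNorm n α K f = ∫⁻ x, ∫⁻ y, ENNReal.ofReal |f x - f y| * k (x - y) := by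
    unfold sobNorm
    congr 1; ext x; congr 1; ext y
    simp only [hkdef]
    rw [← ENNReal.ofReal_mul (abs_nonneg _), mul_one_div]
  set S := sobNorm n α K f with hSdef
  have key : ∀ ε : ℝ, 0 < ε → ENNReal.ofReal (1 - ε - ε) * (2 * I) ≤ S + ENNReal.ofReal ε := by
    intro ε hε
    obtain ⟨g, hg, hgcs, hgf, hreg, hgn⟩ := perturb volume k hk hke hkf f hf hfc ε hε
    rw [hS]
    refine le_trans ?_ hgn
    rw [← coarea_aux volume g hg.continuous.measurable k hk hke]
    calc ENNReal.ofReal (1 - ε - ε) * (2 * I) = ∫⁻ t in Ioo ε (1 - ε), 2 * I := by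
          rw [setLIntegral_const, Real.volume_Ioo, mul_comm]
      _ ≤ ∫⁻ t in Ioo ε (1 - ε), 2 * ∫⁻ x in {x | t < g x}, ∫⁻ y in {x | t < g x}ᶜ, k (x - y) := by
          apply lintegral_mono_ae
          rw [ae_restrict_iff' measurableSet_Ioo]
          filter_upwards [hreg] with t ht htI
          gcongr
          refine iInf₂_le_of_le {x | t < g x} ⟨?_, ?_, ?_, ?_⟩ le_rfl
          · exact isOpen_lt continuous_const hg.continuous
          · refine hgcs.isCompact.isBounded.subset ?_
            intro x hx
            apply subset_tsupport
            have : t < g x := hx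
            have : 0 < g x := by linarith [htI.1]
            exact this.ne'
          · exact smooth_superlevel g hg t (ht htI.1)
          · intro x hx
            have h1 := hfL x
            rw [Set.indicator_of_mem hx] at h1
            have h2 := (abs_le.1 (hgf x)).1
            have h3 := htI.2
            simp only [Pi.one_apply] at h1
            show t < g x
            linarith
      _ ≤ _ := setLIntegral_le_lintegral _ _
  have l1 : Filter.Tendsto (fun ε : ℝ => ENNReal.ofReal (1 - ε - ε) * (2 * I)) (nhdsWithin 0 (Ioi 0))
      (nhds (1 * (2 * I))) := by
    apply ENNReal.Tendsto.mul_const _ (Or.inl one_ne_zero)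
    have : Continuous (fun ε : ℝ => ENNReal.ofReal (1 - ε - ε)) :=
      ENNReal.continuous_ofReal.comp (by fun_prop)
    have h := this.tendsto 0
    simp only [sub_zero, ENNReal.ofReal_one] at h
    exact h.mono_left nhdsWithin_le_nhds
  have l2 : Filter.Tendsto (fun ε : ℝ => S + ENNReal.ofReal ε) (nhdsWithin 0 (Ioi 0)) (nhds (S + 0)) := by
    apply Filter.Tendsto.const_add
    have h := ENNReal.continuous_ofReal.tendsto 0
    simp only [ENNReal.ofReal_zero] at h
    exact h.mono_left nhdsWithin_le_nhds
  have := le_of_tendsto_of_tendsto l1 l2 (by filter_upwards [self_mem_nhdsWithin] with ε hε using key ε hε)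
  simpa using this
end
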